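/- Let G be a connected decomposable claw-free graph with maximum degree 3 such that χ'_irr(G) > 3 and every decomposable claw-free graph with maximum degree at most 3 and fewer edges than G has locally irregular chromatic index at most 3. Then G contains no two adjacent triangles, i.e., no two triangles sharing an edge. -/

import Mathlib

/-- A graph is *locally irregular* if no two adjacent vertices have the same degree. -/
def LocallyIrregular {V : Type*} (G : SimpleGraph V) : Prop :=
  ∀ ⦃u v : V⦄, G.Adj u v → (G.neighborSet u).ncard ≠ (G.neighborSet v).ncard

/-- `HasLIEC G k` : `G` admits a locally irregular edge-coloring using at most `k` colors,
i.e. an assignment of one of `k` colors to every edge such that the edges of each fixed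
color induce a locally irregular graph. -/
def HasLIEC {V : Type*} (G : SimpleGraph V) (k : ℕ) : Prop :=
  ∃ c : Sym2 V → Fin k, ∀ i : Fin k,
    LocallyIrregular (SimpleGraph.fromEdgeSet {e | e ∈ G.edgeSet ∧ c e = i})

/-- A graph is *decomposable* if it admits a locally irregular edge-coloring. -/
def Decomposable {V : Type*} (G : SimpleGraph V) : Prop :=
  ∃ k : ℕ, HasLIEC G k

/-- A graph is *claw-free* if it contains no induced subgraph isomorphic to `K_{1,3}`. -/
def ClawFree {V : Type*} (G : SimpleGraph V) : Prop :=
  ¬ ∃ v a b c : V, a ≠ b ∧ a ≠ c ∧ b ≠ c ∧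
      G.Adj v a ∧ G.Adj v b ∧ G.Adj v c ∧ ¬ G.Adj a b ∧ ¬ G.Adj a c ∧ ¬ G.Adj b c

/-- `G` has maximum degree at most `d`. -/
def MaxDegreeLE {V : Type*} (G : SimpleGraph V) (d : ℕ) : Prop :=
  ∀ v : V, (G.neighborSet v).ncard ≤ d

section Aux
open Classical

noncomputable def cd {V : Type*} {k : ℕ} (G : SimpleGraph V) (c : Sym2 V → Fin k) (i : Fin k)
    (x : V) : ℕ := {y | G.Adj x y ∧ c s(x, y) = i}.ncard

lemma liec_iff {V : Type*} {k : ℕ} (G : SimpleGraph V) : HasLIEC G k ↔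
    ∃ c : Sym2 V → Fin k, ∀ x y, G.Adj x y → cd G c (c s(x, y)) x ≠ cd G c (c s(x, y)) y := by
  have key : ∀ (c : Sym2 V → Fin k) i x,
      ((SimpleGraph.fromEdgeSet {e | e ∈ G.edgeSet ∧ c e = i}).neighborSet x)
        = {y | G.Adj x y ∧ c s(x, y) = i} := by
    intro c i x
    ext y
    simp only [SimpleGraph.mem_neighborSet, SimpleGraph.fromEdgeSet_adj, Set.mem_ofPred_eq,
      SimpleGraph.mem_edgeSet]
    constructor
    · rintro ⟨h, _⟩; exact h
    · intro h; exact ⟨h, h.1.ne⟩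
  unfold HasLIEC LocallyIrregular
  constructor
  · rintro ⟨c, hc⟩
    refine ⟨c, fun x y hxy => ?_⟩
    have := @hc (c s(x, y)) x y (by simp [hxy, hxy.ne])
    rw [key, key] at this
    exact this
  · rintro ⟨c, hc⟩
    refine ⟨c, fun i x y hxy => ?_⟩
    rw [key, key]
    simp only [SimpleGraph.fromEdgeSet_adj, Set.mem_ofPred_eq, SimpleGraph.mem_edgeSet] at hxy
    obtain ⟨⟨h1, rfl⟩, _⟩ := hxy
    exact hc x y h1

lemma cd_eq_sum {V : Type*} {k : ℕ} (G : SimpleGraph V) (c : Sym2 V → Fin k) (i : Fin k)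
    (x : V) (S : Finset V) (hS : ∀ y, G.Adj x y ↔ y ∈ S) :
    cd G c i x = ∑ y ∈ S, if c s(x, y) = i then 1 else 0 := by
  rw [Finset.sum_boole]
  unfold cd
  have : {y | G.Adj x y ∧ c s(x, y) = i} = ((S.filter fun y => c s(x, y) = i : Finset V) : Set V) := by
    ext y; simp [hS]
  rw [this, Set.ncard_coe_finset]; simp

lemma liec_comap {V W : Type*} {k : ℕ} (f : W ≃ V) (H : SimpleGraph V) (h : HasLIEC H k) :
    HasLIEC (H.comap f) k := by
  rw [liec_iff] at h ⊢
  obtain ⟨c, hc⟩ := h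
  have key : ∀ i x, cd (H.comap f) (fun e => c (e.map f)) i x = cd H c i (f x) := by
    intro i x
    unfold cd
    rw [← Set.ncard_image_of_injective _ f.injective]
    congr 1
    ext y
    simp only [Set.mem_image, Set.mem_ofPred_eq, SimpleGraph.comap_adj, Sym2.map_mk]
    constructor
    · rintro ⟨z, hz, rfl⟩; exact hz
    · intro hy; exact ⟨f.symm y, by simpa using hy, by simp⟩
  refine ⟨fun e => c (e.map f), fun x y hxy => ?_⟩
  rw [key, key]
  exact hc _ _ hxy

lemma comap_comap_symm {V W : Type*} (f : W ≃ V) (H : SimpleGraph V) :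
    (H.comap f).comap f.symm = H := by
  ext x y; simp

lemma transfer {V : Type*} [Fintype V] (H : SimpleGraph V) (m : ℕ)
    (hmin : ∀ (W : Type) [Fintype W] (H : SimpleGraph W),
      Decomposable H → ClawFree H → MaxDegreeLE H 3 →
      H.edgeSet.ncard < m → HasLIEC H 3)
    (h1 : Decomposable H) (h2 : ClawFree H) (h3 : MaxDegreeLE H 3) (h4 : H.edgeSet.ncard < m) :
    HasLIEC H 3 := by
  let f : Fin (Fintype.card V) ≃ V := (Fintype.equivFin V).symm
  have := hmin (Fin (Fintype.card V)) (H.comap f) ?_ ?_ ?_ ?_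
  · have h := liec_comap f.symm _ this
    rwa [comap_comap_symm] at h
  · obtain ⟨k, hk⟩ := h1
    exact ⟨k, liec_comap f _ hk⟩
  · rintro ⟨v, a, b, c, hab, hac, hbc, h⟩
    exact h2 ⟨f v, f a, f b, f c, f.injective.ne hab, f.injective.ne hac, f.injective.ne hbc, h⟩
  · intro v
    have : (H.neighborSet (f v)) = f '' ((H.comap f).neighborSet v) := by
      ext y
      simp only [SimpleGraph.mem_neighborSet, Set.mem_image, SimpleGraph.comap_adj]
      constructor
      · intro hy; exact ⟨f.symm y, by simpa using hy, by simp⟩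
      · rintro ⟨z, hz, rfl⟩; exact hz
    have h := h3 (f v)
    rwa [this, Set.ncard_image_of_injective _ f.injective] at h
  · have e : (H.comap f) ≃g H := ⟨f, by simp⟩
    have := Nat.card_congr e.mapEdgeSet
    rw [Nat.card_coe_set_eq, Nat.card_coe_set_eq] at this
    omega

/-! ### Decomposition into paths of length two -/

noncomputable def par {V : Type*} (E : Finset (Sym2 V)) (o : Sym2 V → V) (t : V) : ZMod 2 :=
  ∑ e ∈ E, if o e = t then 1 else 0

lemma par_flip {V : Type*} (E : Finset (Sym2 V)) (o : Sym2 V → V) (ho : ∀ e ∈ E, o e ∈ e)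
    (x y : V) (hxy : s(x, y) ∈ E) :
    ∃ o' : Sym2 V → V, (∀ e ∈ E, o' e ∈ e) ∧ ∀ t, par E o' t = par E o t +
      (if x = t then 1 else 0) + (if y = t then 1 else 0) := by
  have h2 : ∀ a : ZMod 2, a + a = 0 := by decide
  have gen : ∀ p q : V, s(p, q) = s(x, y) → o s(p, q) = p → 
     ∃ o' : Sym2 V → V, (∀ e ∈ E, o' e ∈ e) ∧ ∀ t, par E o' t = par E o t +
      (if p = t then 1 else 0) + (if q = t then 1 else 0) := by
    intro p q hpq hop
    refine ⟨Function.update o s(p, q) q, ?_, ?_⟩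
    · intro e he
      by_cases h : e = s(p, q)
      · subst h; simp
      · rw [Function.update_of_ne h]; exact ho e he
    · intro t
      unfold par
      rw [← hpq] at hxy
      rw [← Finset.add_sum_erase E _ hxy, ← Finset.add_sum_erase E (fun e => if o e = t then 1 else 0) hxy]
      have : ∑ e ∈ E.erase s(p, q), (if Function.update o s(p, q) q e = t then (1 : ZMod 2) else 0)
        = ∑ e ∈ E.erase s(p, q), (if o e = t then (1 : ZMod 2) else 0) := by
        apply Finset.sum_congr rfl
        intro e he
        rw [Function.update_of_ne (Finset.ne_of_mem_erase he)]
      rw [this]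
      simp only [Function.update_self, hop]
      have := h2 (if p = t then (1 : ZMod 2) else 0)
      linear_combination -this
  have := ho _ hxy
  rw [Sym2.mem_iff] at this
  rcases this with h | h
  · exact gen x y rfl h
  · obtain ⟨o', h1, h3⟩ := gen y x Sym2.eq_swap (by rw [Sym2.eq_swap]; exact h)
    refine ⟨o', h1, fun t => ?_⟩
    rw [h3 t]; ring

lemma par_walk {V : Type*} (K : SimpleGraph V) (E : Finset (Sym2 V))
    (hE : ∀ x y, K.Adj x y → s(x, y) ∈ E) (x y : V) (p : K.Walk x y) :
    ∀ o : Sym2 V → V, (∀ e ∈ E, o e ∈ e) →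
    ∃ o' : Sym2 V → V, (∀ e ∈ E, o' e ∈ e) ∧ ∀ t, par E o' t = par E o t +
      (if x = t then 1 else 0) + (if y = t then 1 else 0) := by
  have h2 : ∀ a : ZMod 2, a + a = 0 := by decide
  induction p with
  | nil =>
    intro o ho
    refine ⟨o, ho, fun t => ?_⟩
    rw [add_assoc, h2, add_zero]
  | @cons a b d h p ih =>
    intro o ho
    obtain ⟨o1, ho1, h1⟩ := par_flip E o ho a b (hE _ _ h)
    obtain ⟨o3, ho3, h3⟩ := ih o1 ho1
    refine ⟨o3, ho3, fun t => ?_⟩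
    rw [h3, h1]
    have := h2 (if b = t then (1 : ZMod 2) else 0)
    linear_combination this

lemma par_push {V : Type*} (K : SimpleGraph V) (E : Finset (Sym2 V))
    (hE : ∀ x y, K.Adj x y → s(x, y) ∈ E) (u v : V) (S : Finset V)
    (hS : ∀ x ∈ S, x ≠ u ∧ x ≠ v ∧ (K.Reachable x u ∨ K.Reachable x v)) :
    ∃ o : Sym2 V → V, (∀ e ∈ E, o e ∈ e) ∧ ∀ t ∈ S, par E o t = 0 := by
  induction S using Finset.induction_on with
  | empty => exact ⟨fun e => e.out.1, fun e _ => Sym2.out_fst_mem e, by simp⟩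
  | insert x S hx ih =>
    obtain ⟨o, ho, h⟩ := ih (fun y hy => hS y (Finset.mem_insert_of_mem hy))
    obtain ⟨hxu, hxv, hr⟩ := hS x (Finset.mem_insert_self _ _)
    have h01 : par E o x = 0 ∨ par E o x = 1 := by
      generalize par E o x = a
      revert a; decide
    rcases h01 with h0 | h1
    · refine ⟨o, ho, fun t ht => ?_⟩
      rcases Finset.mem_insert.1 ht with rfl | ht
      · exact h0
      · exact h t ht
    · have : ∃ d, (d = u ∨ d = v) ∧ K.Reachable x d := by
        rcases hr with hr | hr
        · exact ⟨u, .inl rfl, hr⟩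
        · exact ⟨v, .inr rfl, hr⟩
      obtain ⟨d, hd, ⟨p⟩⟩ := this
      obtain ⟨o', ho', h'⟩ := par_walk K E hE x d p o ho
      refine ⟨o', ho', fun t ht => ?_⟩
      have htd : d ≠ t := by
        have := hS t ht
        rintro rfl
        rcases hd with rfl | rfl
        · exact this.1 rfl
        · exact this.2.1 rfl
      rw [h']
      rcases Finset.mem_insert.1 ht with rfl | ht
      · rw [h1]; simp [htd]; decide
      · have : x ≠ t := by rintro rfl; exact hx ht
        simp [h t ht, htd, this]

lemma two_path_irr {V : Type*} (t y z : V) (hy : t ≠ y) (hz : t ≠ z) (hyz : y ≠ z)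
    (S : Set (Sym2 V)) (hS : ∀ e, e ∈ S ↔ e = s(t, y) ∨ e = s(t, z)) :
    LocallyIrregular (SimpleGraph.fromEdgeSet S) := by
  have ht : (SimpleGraph.fromEdgeSet S).neighborSet t = {y, z} := by
    ext a
    simp only [SimpleGraph.mem_neighborSet, SimpleGraph.fromEdgeSet_adj, hS]
    simp; grind
  have hy' : (SimpleGraph.fromEdgeSet S).neighborSet y = {t} := by
    ext a
    simp only [SimpleGraph.mem_neighborSet, SimpleGraph.fromEdgeSet_adj, hS]
    simp; grind
  have hz' : (SimpleGraph.fromEdgeSet S).neighborSet z = {t} := by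
    ext a
    simp only [SimpleGraph.mem_neighborSet, SimpleGraph.fromEdgeSet_adj, hS]
    simp; grind
  intro a b hab
  simp only [SimpleGraph.fromEdgeSet_adj, hS] at hab
  have : (a = t ∧ b = y) ∨ (a = y ∧ b = t) ∨ (a = t ∧ b = z) ∨ (a = z ∧ b = t) := by
    simp at hab; tauto
  rcases this with ⟨rfl, rfl⟩ | ⟨rfl, rfl⟩ | ⟨rfl, rfl⟩ | ⟨rfl, rfl⟩ <;>
    simp [ht, hy', hz', Set.ncard_pair hyz]

lemma pairing {V : Type*} [Fintype V] (n : ℕ) : ∀ (E : Finset (Sym2 V)), E.card = n →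
    (∀ e ∈ E, ¬ e.IsDiag) → ∀ (o : Sym2 V → V), (∀ e ∈ E, o e ∈ e) →
    (∀ t, par E o t = 0) →
    ∃ c : Sym2 V → ℕ, ∀ i, LocallyIrregular (SimpleGraph.fromEdgeSet {e | e ∈ E ∧ c e = i}) := by
  induction n using Nat.strong_induction_on with
  | _ n ih =>
  intro E hn hdiag o ho hpar
  rcases E.eq_empty_or_nonempty with rfl | ⟨e, he⟩
  · exact ⟨fun _ => 0, fun i u v h => by simp at h⟩
  · obtain ⟨f, hf⟩ : ∃ f ∈ E.erase e, o f = o e := by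
      by_contra! hcon
      have := hpar (o e)
      unfold par at this
      rw [← Finset.add_sum_erase E _ he] at this
      rw [Finset.sum_eq_zero (fun f hf => by simp [hcon f hf])] at this
      simp at this
    obtain ⟨hfE, hfo⟩ := hf
    have hfe := Finset.ne_of_mem_erase hfE
    have hfE' := Finset.mem_of_mem_erase hfE
    have hc1 := Finset.card_erase_lt_of_mem hfE
    have hc2 := Finset.card_erase_lt_of_mem he
    obtain ⟨c, hc⟩ := ih ((E.erase e).erase f).card (by omega) _ rfl
      (fun g hg => hdiag g (Finset.mem_of_mem_erase (Finset.mem_of_mem_erase hg))) o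
      (fun g hg => ho g (Finset.mem_of_mem_erase (Finset.mem_of_mem_erase hg)))
      (fun t => by
        have := hpar t
        unfold par at this ⊢
        rw [← Finset.add_sum_erase E _ he, ← Finset.add_sum_erase _ _ hfE, hfo, ← add_assoc] at this
        rwa [(by decide : ∀ a : ZMod 2, a + a = 0), zero_add] at this)
    let N := (Finset.univ.sup c) + 1
    have hN : ∀ g, c g ≠ N := fun g => by
      have : c g ≤ Finset.univ.sup c := Finset.le_sup (Finset.mem_univ g)
      omega
    refine ⟨fun g => if g = e ∨ g = f then N else c g, fun i => ?_⟩
    by_cases hi : i = N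
    · obtain ⟨y, hy⟩ := Sym2.mem_iff_exists.1 (ho e he)
      obtain ⟨z, hz⟩ := Sym2.mem_iff_exists.1 (ho f hfE')
      rw [hfo] at hz
      have d1 := hdiag e he
      have d2 := hdiag f hfE'
      rw [hy, Sym2.mk_isDiag_iff] at d1
      rw [hz, Sym2.mk_isDiag_iff] at d2
      refine two_path_irr (o e) y z d1 d2 ?_ _ ?_
      · intro hyz; apply hfe; rw [hy, hz, hyz]
      · intro g
        rw [← hy, ← hz, hi]
        simp only [Set.mem_ofPred_eq]
        constructor
        · rintro ⟨_, h⟩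
          by_contra hcon
          rw [if_neg hcon] at h
          exact hN g h
        · intro h
          refine ⟨?_, if_pos h⟩
          rcases h with rfl | rfl <;> assumption
    · convert hc i using 2
      ext g
      simp only [Set.mem_ofPred_eq, Finset.mem_erase]
      by_cases h : g = e ∨ g = f
      · simp only [h, if_true]
        constructor
        · rintro ⟨_, h⟩; exact absurd h.symm hi
        · rintro ⟨⟨h1, h2, _⟩, _⟩; tauto
      · simp only [h, if_false]; tauto

lemma decomp_of_even {V : Type*} [Fintype V] (H : SimpleGraph V) (E : Finset (Sym2 V))
    (hE : ∀ e, e ∈ E ↔ e ∈ H.edgeSet) (o : Sym2 V → V)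
    (ho : ∀ e ∈ E, o e ∈ e) (hpar : ∀ t, par E o t = 0) :
    Decomposable H := by
  obtain ⟨c, hc⟩ := pairing _ E rfl
    (fun e he => H.not_isDiag_of_mem_edgeSet ((hE e).1 he)) o ho hpar
  let N := (Finset.univ.sup c) + 1
  have hN : ∀ g, c g < N := fun g => by
    have : c g ≤ Finset.univ.sup c := Finset.le_sup (Finset.mem_univ g)
    omega
  refine ⟨N, fun e => ⟨c e, hN e⟩, fun i => ?_⟩
  convert hc i.1 using 2
  ext g
  simp [Fin.ext_iff, hE]

def wit (c1 c2 : Option (Fin 3)) (a b : ℕ) : Fin 3 × Fin 3 × Fin 3 × Fin 3 × Fin 3 :=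
  let same (x : Fin 3) (p q : Bool) : Fin 3 × Fin 3 × Fin 3 × Fin 3 × Fin 3 :=
    if p then (x, x + 1, x + 2, x + 1, x + 2)
    else if q then (x + 2, x + 1, x, x + 1, x + 2)
    else (x + 1, x + 2, x + 1, x + 2, x + 1)
  match c1, c2 with
  | none, none => same 0 false false
  | none, some y => same y false (b < 2)
  | some x, none => same x (a < 2) false
  | some x, some y =>
    if x = y then same x (a < 2) (b < 2)
    else
      let t := -(x + y)
      if a < 2 ∧ b < 2 then (x, x, t, y, t)
      else if a ≤ 2 ∧ 2 ≤ b then (x, x, x, t, t)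
      else if b ≤ 2 then (y, t, y, y, t)
      else (x, t, y, t, t)

def ind {T : Type*} [DecidableEq T] (x y : T) : ℕ := if x = y then 1 else 0

def Good (c1 c2 : Option (Fin 3)) (a b : ℕ) (p : Fin 3 × Fin 3 × Fin 3 × Fin 3 × Fin 3) : Prop :=
  let du := fun i => ind p.1 i + ind p.2.1 i + ind c1 (some i)
  let dv := fun i => ind p.2.2.1 i + ind p.2.2.2.1 i + ind c2 (some i)
  let dw := fun i => ind p.1 i + ind p.2.2.1 i + ind p.2.2.2.2 i
  let dz := fun i => ind p.2.1 i + ind p.2.2.2.1 i + ind p.2.2.2.2 i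
  (∀ i, c1 = some i → du i ≠ a) ∧ (∀ i, c2 = some i → dv i ≠ b) ∧
  du p.1 ≠ dw p.1 ∧ du p.2.1 ≠ dz p.2.1 ∧ dv p.2.2.1 ≠ dw p.2.2.1 ∧
  dv p.2.2.2.1 ≠ dz p.2.2.2.1 ∧ dw p.2.2.2.2 ≠ dz p.2.2.2.2

instance (c1 c2 : Option (Fin 3)) (a b : ℕ) (p : Fin 3 × Fin 3 × Fin 3 × Fin 3 × Fin 3) :
    Decidable (Good c1 c2 a b p) := by unfold Good; infer_instance

set_option maxRecDepth 100000 in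
lemma wit_good_fin : ∀ (c1 c2 : Option (Fin 3)) (a b : Fin 4), 1 ≤ a.1 → 1 ≤ b.1 → 
    ¬ (c1 ≠ none ∧ c1 = c2 ∧ a.1 = 1 ∧ b.1 = 1) →
    Good c1 c2 a b (wit c1 c2 a b) := by decide

lemma wit_good (c1 c2 : Option (Fin 3)) (a b : ℕ) (ha : a ≤ 3) (hb : b ≤ 3) (ha1 : 1 ≤ a)
    (hb1 : 1 ≤ b) (h : ¬ (c1 ≠ none ∧ c1 = c2 ∧ a = 1 ∧ b = 1)) : ∃ p, Good c1 c2 a b p :=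
  ⟨_, wit_good_fin c1 c2 ⟨a, by omega⟩ ⟨b, by omega⟩ ha1 hb1 h⟩

lemma optU {V : Type*} (U : Finset V) (hU : U.card ≤ 1) (f : V → Fin 3) (g : V → ℕ)
    (hg : ∀ y, g y ≤ 3) (hg1 : ∀ y ∈ U, 1 ≤ g y) :
    ∃ (c1 : Option (Fin 3)) (a : ℕ), a ≤ 3 ∧ 1 ≤ a ∧
      (∀ i, (∑ y ∈ U, if f y = i then 1 else 0) = ind c1 (some i)) ∧
      (∀ y ∈ U, c1 = some (f y) ∧ a = g y) ∧
      (c1 ≠ none → ∃ y, U = {y}) := by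
  rcases U.eq_empty_or_nonempty with rfl | hne
  · exact ⟨none, 1, by simp, le_rfl, by simp [ind], by simp, by simp⟩
  · obtain ⟨y, rfl⟩ := Finset.card_eq_one.1 (le_antisymm hU hne.card_pos)
    refine ⟨some (f y), g y, hg y, hg1 y (by simp),
      fun i => by rw [Finset.sum_singleton]; simp [ind], by simp, fun _ => ⟨y, rfl⟩⟩

lemma extend {V : Type*} [Fintype V] (G H : SimpleGraph V) (u v w z : V)
    (huv : u ≠ v) (huw : u ≠ w) (huz : u ≠ z) (hvw : v ≠ w) (hvz : v ≠ z) (hwz : w ≠ z)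
    (hdeg : MaxDegreeLE H 3)
    (hw : ∀ y, G.Adj w y ↔ y = u ∨ y = v ∨ y = z)
    (hz : ∀ y, G.Adj z y ↔ y = u ∨ y = v ∨ y = w)
    (U S : Finset V) (hUc : U.card ≤ 1) (hSc : S.card ≤ 1)
    (hU : ∀ y, G.Adj u y ↔ y = w ∨ y = z ∨ y ∈ U)
    (hS : ∀ y, G.Adj v y ↔ y = w ∨ y = z ∨ y ∈ S)
    (hUd : ∀ y ∈ U, y ≠ u ∧ y ≠ v ∧ y ≠ w ∧ y ≠ z)
    (hSd : ∀ y ∈ S, y ≠ u ∧ y ≠ v ∧ y ≠ w ∧ y ≠ z)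
    (su sv : Prop)
    (hHG : ∀ x y, x ≠ u → x ≠ v → x ≠ w → x ≠ z → (H.Adj x y ↔ G.Adj x y))
    (hHu : ∀ y, H.Adj u y ↔ (y = w ∧ su) ∨ y ∈ U)
    (hHv : ∀ y, H.Adj v y ↔ (y = w ∧ sv) ∨ y ∈ S)
    (hHw : ∀ y, H.Adj w y ↔ (y = u ∧ su) ∨ (y = v ∧ sv))
    (hH : HasLIEC H 3) : HasLIEC G 3 := by
  rw [liec_iff] at hH ⊢
  obtain ⟨c, hc⟩ := hH
  have hle : ∀ i x, cd H c i x ≤ 3 := fun i x =>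
    (Set.ncard_le_ncard (fun y hy => hy.1) (Set.toFinite _)).trans (hdeg x)
  have hpos : ∀ x y, H.Adj x y → 1 ≤ cd H c (c s(x, y)) y := fun x y h =>
    (Set.ncard_pos (Set.toFinite _)).2 ⟨x, h.symm, by rw [Sym2.eq_swap]⟩
  obtain ⟨c1, a, ha, ha1, hs1, hm1, hn1⟩ := optU U hUc (fun y => c s(u, y))
    (fun y => cd H c (c s(u, y)) y) (fun y => hle _ _)
    (fun y hy => hpos u y ((hHu y).2 (.inr hy)))
  obtain ⟨c2, b, hb, hb1, hs2, hm2, hn2⟩ := optU S hSc (fun y => c s(v, y))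
    (fun y => cd H c (c s(v, y)) y) (fun y => hle _ _)
    (fun y hy => hpos v y ((hHv y).2 (.inr hy)))
  have hhyp : ¬ (c1 ≠ none ∧ c1 = c2 ∧ a = 1 ∧ b = 1) := by
    rintro ⟨h1, h2, rfl, rfl⟩
    obtain ⟨u', rfl⟩ := hn1 h1
    obtain ⟨v', rfl⟩ := hn2 (h2 ▸ h1)
    obtain ⟨e1, f1⟩ := hm1 u' (by simp)
    obtain ⟨e2, f2⟩ := hm2 v' (by simp)
    have hu' := hUd u' (by simp)
    have hv' := hSd v' (by simp)
    have hcc : c s(u, u') = c s(v, v') := by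
      rw [e1, e2] at h2; exact Option.some.inj h2
    have g1 := hc u u' ((hHu u').2 (by simp))
    have g2 := hc v v' ((hHv v').2 (by simp))
    have k1 : su ∧ c s(u, w) = c s(u, u') := by
      by_contra hcon
      apply g1
      rw [← f1, cd, Set.ncard_eq_one]
      refine ⟨u', ?_⟩
      ext y
      simp only [hHu, Set.mem_ofPred_eq, Finset.mem_singleton, Set.mem_singleton_iff]
      constructor
      · rintro ⟨⟨rfl, h⟩ | h, h'⟩
        · exact absurd ⟨h, h'⟩ hcon
        · exact h
      · rintro rfl; exact ⟨.inr rfl, rfl⟩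
    have k2 : sv ∧ c s(v, w) = c s(v, v') := by
      by_contra hcon
      apply g2
      rw [← f2, cd, Set.ncard_eq_one]
      refine ⟨v', ?_⟩
      ext y
      simp only [hHv, Set.mem_ofPred_eq, Finset.mem_singleton, Set.mem_singleton_iff]
      constructor
      · rintro ⟨⟨rfl, h⟩ | h, h'⟩
        · exact absurd ⟨h, h'⟩ hcon
        · exact h
      · rintro rfl; exact ⟨.inr rfl, rfl⟩
    apply hc u w ((hHu w).2 (.inl ⟨rfl, k1.1⟩))
    rw [cd_eq_sum H c _ u {w, u'} (by intro y; rw [hHu]; simp [k1.1]),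
      cd_eq_sum H c _ w {u, v} (by intro y; rw [hHw]; simp [k1.1, k2.1])]
    rw [Finset.sum_pair hu'.2.2.1.symm, Finset.sum_pair huv]
    rw [k1.2, Sym2.eq_swap (a := w) (b := u), Sym2.eq_swap (a := w) (b := v), k1.2, k2.2, hcc]
  obtain ⟨⟨p1, p2, p3, p4, p5⟩, hgood⟩ := wit_good c1 c2 a b ha hb ha1 hb1 hhyp
  simp only [Good] at hgood
  obtain ⟨q1, q2, q3, q4, q5, q6, q7⟩ := hgood
  let c' : Sym2 V → Fin 3 := fun e =>
    if e = s(u, w) then p1 else if e = s(u, z) then p2 else if e = s(v, w) then p3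
    else if e = s(v, z) then p4 else if e = s(w, z) then p5 else c e
  have r1 : c' s(u, w) = p1 := by simp [c']
  have r2 : c' s(u, z) = p2 := by simp only [c', Sym2.eq_iff]; grind
  have r3 : c' s(v, w) = p3 := by simp only [c', Sym2.eq_iff]; grind
  have r4 : c' s(v, z) = p4 := by simp only [c', Sym2.eq_iff]; grind
  have r5 : c' s(w, z) = p5 := by simp only [c', Sym2.eq_iff]; grind
  have r1' : c' s(w, u) = p1 := by rw [Sym2.eq_swap, r1]
  have r2' : c' s(z, u) = p2 := by rw [Sym2.eq_swap, r2]
  have r3' : c' s(w, v) = p3 := by rw [Sym2.eq_swap, r3]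
  have r4' : c' s(z, v) = p4 := by rw [Sym2.eq_swap, r4]
  have r5' : c' s(z, w) = p5 := by rw [Sym2.eq_swap, r5]
  have r0 : ∀ x y, x ≠ u → x ≠ v → x ≠ w → x ≠ z → c' s(x, y) = c s(x, y) := by
    intro x y h1 h2 h3 h4
    simp [c', h1, h2, h3, h4]
  have r0' : ∀ x y, x ≠ u → x ≠ v → x ≠ w → x ≠ z → c' s(y, x) = c s(y, x) := by
    intro x y h1 h2 h3 h4
    rw [Sym2.eq_swap, r0 x y h1 h2 h3 h4]
  have du : ∀ i, cd G c' i u = ind p1 i + ind p2 i + ind c1 (some i) := by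
    intro i
    rw [cd_eq_sum G c' i u (insert w (insert z U)) (by intro y; rw [hU]; simp),
      Finset.sum_insert, Finset.sum_insert, r1, r2, ← hs1, add_assoc]
    · congr 2
      apply Finset.sum_congr rfl
      intro y hy
      obtain ⟨h1, h2, h3, h4⟩ := hUd y hy
      rw [r0' y u h1 h2 h3 h4]
    · intro h; exact (hUd _ h).2.2.2 rfl
    · intro h
      rcases Finset.mem_insert.1 h with h | h
      · exact hwz h
      · exact (hUd _ h).2.2.1 rfl
  have dv : ∀ i, cd G c' i v = ind p3 i + ind p4 i + ind c2 (some i) := by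
    intro i
    rw [cd_eq_sum G c' i v (insert w (insert z S)) (by intro y; rw [hS]; simp),
      Finset.sum_insert, Finset.sum_insert, r3, r4, ← hs2, add_assoc]
    · congr 2
      apply Finset.sum_congr rfl
      intro y hy
      obtain ⟨h1, h2, h3, h4⟩ := hSd y hy
      rw [r0' y v h1 h2 h3 h4]
    · intro h; exact (hSd _ h).2.2.2 rfl
    · intro h
      rcases Finset.mem_insert.1 h with h | h
      · exact hwz h
      · exact (hSd _ h).2.2.1 rfl
  have dw : ∀ i, cd G c' i w = ind p1 i + ind p3 i + ind p5 i := by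
    intro i
    rw [cd_eq_sum G c' i w {u, v, z} (by intro y; rw [hw]; simp),
      Finset.sum_insert (by simp [huv, huz]), Finset.sum_pair hvz, r1', r3', r5, add_assoc]
    rfl
  have dz : ∀ i, cd G c' i z = ind p2 i + ind p4 i + ind p5 i := by
    intro i
    rw [cd_eq_sum G c' i z {u, v, w} (by intro y; rw [hz]; simp),
      Finset.sum_insert (by simp [huv, huw]), Finset.sum_pair hvw, r2', r4', r5', add_assoc]
    rfl
  have dx : ∀ i x, x ≠ u → x ≠ v → x ≠ w → x ≠ z → cd G c' i x = cd H c i x := by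
    intro i x h1 h2 h3 h4
    unfold cd
    congr 1
    ext y
    simp only [Set.mem_ofPred_eq, r0 x y h1 h2 h3 h4, hHG x y h1 h2 h3 h4]
  refine ⟨c', ?_⟩
  let P : V → V → Prop := fun x y => cd G c' (c' s(x, y)) x ≠ cd G c' (c' s(x, y)) y
  have Psymm : ∀ x y, P x y → P y x := by
    intro x y h
    simp only [P] at h ⊢
    rw [Sym2.eq_swap]
    exact h.symm
  have puw : P u w := by simp only [P, r1, du, dw]; exact q3
  have puz : P u z := by simp only [P, r2, du, dz]; exact q4
  have pvw : P v w := by simp only [P, r3, dv, dw]; exact q5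
  have pvz : P v z := by simp only [P, r4, dv, dz]; exact q6
  have pwz : P w z := by simp only [P, r5, dw, dz]; exact q7
  have pu : ∀ y, G.Adj u y → P u y := by
    intro y hy
    rcases (hU y).1 hy with rfl | rfl | h
    · exact puw
    · exact puz
    · obtain ⟨h1, h2, h3, h4⟩ := hUd y h
      obtain ⟨e1, e2⟩ := hm1 y h
      simp only [P, r0' y u h1 h2 h3 h4, du, dx _ y h1 h2 h3 h4, ← e2]
      exact q1 _ e1
  have pv : ∀ y, G.Adj v y → P v y := by
    intro y hy
    rcases (hS y).1 hy with rfl | rfl | h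
    · exact pvw
    · exact pvz
    · obtain ⟨h1, h2, h3, h4⟩ := hSd y h
      obtain ⟨e1, e2⟩ := hm2 y h
      simp only [P, r0' y v h1 h2 h3 h4, dv, dx _ y h1 h2 h3 h4, ← e2]
      exact q2 _ e1
  have pw : ∀ y, G.Adj w y → P w y := by
    intro y hy
    rcases (hw y).1 hy with rfl | rfl | rfl
    · exact Psymm _ _ puw
    · exact Psymm _ _ pvw
    · exact pwz
  have pz : ∀ y, G.Adj z y → P z y := by
    intro y hy
    rcases (hz y).1 hy with rfl | rfl | rfl
    · exact Psymm _ _ puz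
    · exact Psymm _ _ pvz
    · exact Psymm _ _ pwz
  intro x y hxy
  change P x y
  have main : ∀ x y, G.Adj x y → (x = u ∨ x = v ∨ x = w ∨ x = z) → P x y := by
    rintro x y h (rfl | rfl | rfl | rfl)
    exacts [pu y h, pv y h, pw y h, pz y h]
  by_cases hx : x = u ∨ x = v ∨ x = w ∨ x = z
  · exact main x y hxy hx
  by_cases hy : y = u ∨ y = v ∨ y = w ∨ y = z
  · exact Psymm _ _ (main y x hxy.symm hy)
  push Not at hx hy
  obtain ⟨h1, h2, h3, h4⟩ := hx
  obtain ⟨k1, k2, k3, k4⟩ := hy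
  simp only [P, r0 x y h1 h2 h3 h4, dx _ x h1 h2 h3 h4, dx _ y k1 k2 k3 k4]
  exact hc x y ((hHG x y h1 h2 h3 h4).2 hxy)

lemma nbr4 {V : Type*} [Fintype V] {G : SimpleGraph V} (hdeg : MaxDegreeLE G 3) {x a b c d : V}
    (ha : G.Adj x a) (hb : G.Adj x b) (hc : G.Adj x c) (hd : G.Adj x d)
    (hab : a ≠ b) (hac : a ≠ c) (hbc : b ≠ c) : d = a ∨ d = b ∨ d = c := by
  by_contra! h
  have h1 : (({a, b, c, d} : Finset V) : Set V) ⊆ G.neighborSet x := by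
    intro y hy
    simp at hy
    rcases hy with rfl | rfl | rfl | rfl <;> assumption
  have h2 := Set.ncard_le_ncard h1 (Set.toFinite _)
  rw [Set.ncard_coe_finset] at h2
  have h3 : ({a, b, c, d} : Finset V).card = 4 := by
    rw [Finset.card_insert_of_notMem, Finset.card_insert_of_notMem, Finset.card_pair] <;> simp <;> grind
  have := hdeg x
  omega

lemma k4_case {V : Type*} [Fintype V] (G : SimpleGraph V) (u v w z : V)
    (huv : u ≠ v) (huw : u ≠ w) (huz : u ≠ z) (hvw : v ≠ w) (hvz : v ≠ z) (hwz : w ≠ z)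
    (hconn : G.Connected)
    (hu : ∀ y, G.Adj u y ↔ y = v ∨ y = w ∨ y = z)
    (hv : ∀ y, G.Adj v y ↔ y = u ∨ y = w ∨ y = z)
    (hw : ∀ y, G.Adj w y ↔ y = u ∨ y = v ∨ y = z)
    (hz : ∀ y, G.Adj z y ↔ y = u ∨ y = v ∨ y = w) : HasLIEC G 3 := by
  have hall : ∀ x, x = u ∨ x = v ∨ x = w ∨ x = z := by
    intro x
    obtain ⟨p⟩ := hconn.preconnected x u
    clear hconn
    induction p with
    | nil => exact .inl rfl
    | @cons a b d h p ih =>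
      have := ih huv huw huz hu hv hw hz
      rcases this with rfl | rfl | rfl | rfl
      · have := (hu a).1 h.symm; tauto
      · have := (hv a).1 h.symm; tauto
      · have := (hw a).1 h.symm; tauto
      · have := (hz a).1 h.symm; tauto
  rw [liec_iff]
  let c : Sym2 V → Fin 3 := fun e =>
    if e = s(u, v) ∨ e = s(u, w) then 0 else if e = s(z, u) ∨ e = s(z, v) then 1 else 2
  have r1 : c s(u, v) = 0 := by simp [c]
  have r2 : c s(u, w) = 0 := by simp [c]
  have r3 : c s(u, z) = 1 := by simp only [c, Sym2.eq_iff]; grind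
  have r4 : c s(v, z) = 1 := by simp only [c, Sym2.eq_iff]; grind
  have r5 : c s(v, w) = 2 := by simp only [c, Sym2.eq_iff]; grind
  have r6 : c s(w, z) = 2 := by simp only [c, Sym2.eq_iff]; grind
  have r1' : c s(v, u) = 0 := by rw [Sym2.eq_swap, r1]
  have r2' : c s(w, u) = 0 := by rw [Sym2.eq_swap, r2]
  have r3' : c s(z, u) = 1 := by rw [Sym2.eq_swap, r3]
  have r4' : c s(z, v) = 1 := by rw [Sym2.eq_swap, r4]
  have r5' : c s(w, v) = 2 := by rw [Sym2.eq_swap, r5]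
  have r6' : c s(z, w) = 2 := by rw [Sym2.eq_swap, r6]
  have du : ∀ i, cd G c i u = ind 0 i + (ind 0 i + ind 1 i) := by
    intro i
    rw [cd_eq_sum G c i u {v, w, z} (by intro y; rw [hu]; simp),
      Finset.sum_insert (by simp [hvw, hvz]), Finset.sum_pair hwz, r1, r2, r3]
    rfl
  have dv : ∀ i, cd G c i v = ind 0 i + (ind 2 i + ind 1 i) := by
    intro i
    rw [cd_eq_sum G c i v {u, w, z} (by intro y; rw [hv]; simp),
      Finset.sum_insert (by simp [huw, huz]), Finset.sum_pair hwz, r1', r5, r4]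
    rfl
  have dw : ∀ i, cd G c i w = ind 0 i + (ind 2 i + ind 2 i) := by
    intro i
    rw [cd_eq_sum G c i w {u, v, z} (by intro y; rw [hw]; simp),
      Finset.sum_insert (by simp [huv, huz]), Finset.sum_pair hvz, r2', r5', r6]
    rfl
  have dz : ∀ i, cd G c i z = ind 1 i + (ind 1 i + ind 2 i) := by
    intro i
    rw [cd_eq_sum G c i z {u, v, w} (by intro y; rw [hz]; simp),
      Finset.sum_insert (by simp [huv, huw]), Finset.sum_pair hvw, r3', r4', r6']
    rfl
  refine ⟨c, fun x y hxy => ?_⟩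
  have hxy' := hxy.ne
  rcases hall x with rfl | rfl | rfl | rfl <;> rcases hall y with rfl | rfl | rfl | rfl <;>
    first
    | exact absurd rfl hxy'
    | (simp only [r1, r2, r3, r4, r5, r6, r1', r2', r3', r4', r5', r6', du, dv, dw, dz]; decide)

lemma small_nbr {V : Type*} (T : Finset V) (p a b d : V) (hT : T.card ≤ 1)
    (hab : a ≠ b) (had : a ≠ d) (hbd : b ≠ d)
    (e1 : a = p ∨ a ∈ T) (e2 : b = p ∨ b ∈ T) (e3 : d = p ∨ d ∈ T) : False := by
  rw [Finset.card_le_one] at hT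
  rcases e1 with rfl | e1
  · exact hbd (hT b (e2.resolve_left hab.symm) d (e3.resolve_left had.symm))
  · rcases e2 with rfl | e2
    · exact had (hT a e1 d (e3.resolve_left hbd.symm))
    · exact hab (hT a e1 b e2)

set_option maxHeartbeats 2000000 in
lemma core {V : Type*} [Fintype V] (G : SimpleGraph V)
    (hconn : G.Connected) (hclaw : ClawFree G)
    (hdeg : MaxDegreeLE G 3)
    (hmin : ∀ (W : Type) [Fintype W] (H : SimpleGraph W),
      Decomposable H → ClawFree H → MaxDegreeLE H 3 →
      H.edgeSet.ncard < G.edgeSet.ncard → HasLIEC H 3)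
    (u v w z : V) (huv : u ≠ v) (huw : u ≠ w) (huz : u ≠ z) (hvw : v ≠ w) (hvz : v ≠ z)
    (hwz : w ≠ z) (awz : G.Adj w z) (auw : G.Adj u w) (auz : G.Adj u z) (avw : G.Adj v w)
    (avz : G.Adj v z) : HasLIEC G 3 := by
  have hw : ∀ y, G.Adj w y ↔ y = u ∨ y = v ∨ y = z := fun y =>
    ⟨fun h => nbr4 hdeg auw.symm avw.symm awz h huv huz hvz, by
      rintro (rfl | rfl | rfl); exacts [auw.symm, avw.symm, awz]⟩
  have hz : ∀ y, G.Adj z y ↔ y = u ∨ y = v ∨ y = w := fun y =>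
    ⟨fun h => nbr4 hdeg auz.symm avz.symm awz.symm h huv huw hvw, by
      rintro (rfl | rfl | rfl); exacts [auz.symm, avz.symm, awz.symm]⟩
  by_cases auv : G.Adj u v
  · refine k4_case G u v w z huv huw huz hvw hvz hwz hconn (fun y => ?_) (fun y => ?_) hw hz
    · exact ⟨fun h => nbr4 hdeg auv auw auz h hvw hvz hwz, by
        rintro (rfl | rfl | rfl) <;> assumption⟩
    · exact ⟨fun h => nbr4 hdeg auv.symm avw avz h huw huz hwz, by
        rintro (rfl | rfl | rfl); exacts [auv.symm, avw, avz]⟩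
  have avu : ¬ G.Adj v u := fun h => auv h.symm
  let D : V → Prop := fun x => x = u ∨ x = v ∨ x = w ∨ x = z
  let K : SimpleGraph V :=
    { Adj := fun x y => G.Adj x y ∧ ¬ (D x ∧ D y)
      symm := ⟨fun x y h => ⟨h.1.symm, fun h' => h.2 h'.symm⟩⟩
      loopless := ⟨fun x h => h.1.ne rfl⟩ }
  have hKA : ∀ x y, K.Adj x y ↔ G.Adj x y ∧ ¬ (D x ∧ D y) := fun x y => Iff.rfl
  let U : Finset V := Finset.univ.filter fun y => G.Adj u y ∧ y ≠ w ∧ y ≠ z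
  let S : Finset V := Finset.univ.filter fun y => G.Adj v y ∧ y ≠ w ∧ y ≠ z
  have hUm : ∀ y, y ∈ U ↔ G.Adj u y ∧ y ≠ w ∧ y ≠ z := by simp [U]
  have hSm : ∀ y, y ∈ S ↔ G.Adj v y ∧ y ≠ w ∧ y ≠ z := by simp [S]
  have hUd : ∀ y ∈ U, y ≠ u ∧ y ≠ v ∧ y ≠ w ∧ y ≠ z := by
    intro y hy
    rw [hUm] at hy
    exact ⟨hy.1.ne', fun h => auv (h ▸ hy.1), hy.2⟩
  have hSd : ∀ y ∈ S, y ≠ u ∧ y ≠ v ∧ y ≠ w ∧ y ≠ z := by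
    intro y hy
    rw [hSm] at hy
    exact ⟨fun h => avu (h ▸ hy.1), hy.1.ne', hy.2⟩
  have hUc : U.card ≤ 1 := by
    rw [Finset.card_le_one]
    intro a ha b hb
    rw [hUm] at ha hb
    have := nbr4 hdeg auw auz ha.1 hb.1 hwz ha.2.1.symm ha.2.2.symm
    grind
  have hSc : S.card ≤ 1 := by
    rw [Finset.card_le_one]
    intro a ha b hb
    rw [hSm] at ha hb
    have := nbr4 hdeg avw avz ha.1 hb.1 hwz ha.2.1.symm ha.2.2.symm
    grind
  have hU : ∀ y, G.Adj u y ↔ y = w ∨ y = z ∨ y ∈ U := by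
    intro y; rw [hUm]
    constructor
    · intro h; tauto
    · rintro (rfl | rfl | h)
      exacts [auw, auz, h.1]
  have hS : ∀ y, G.Adj v y ↔ y = w ∨ y = z ∨ y ∈ S := by
    intro y; rw [hSm]
    constructor
    · intro h; tauto
    · rintro (rfl | rfl | h)
      exacts [avw, avz, h.1]
  -- reachability
  have hreach : ∀ x, x = w ∨ x = z ∨ K.Reachable x u ∨ K.Reachable x v := by
    have gen : ∀ x y, y = u → G.Walk x y → 
        (x = w ∨ x = z ∨ K.Reachable x u ∨ K.Reachable x v) := by
      intro x y hy p
      induction p with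
      | nil => subst hy; exact .inr (.inr (.inl (SimpleGraph.Reachable.refl _)))
      | @cons a b d h p ih =>
        by_cases hD : D a
        · rcases hD with rfl | rfl | rfl | rfl
          · exact .inr (.inr (.inl (SimpleGraph.Reachable.refl _)))
          · exact .inr (.inr (.inr (SimpleGraph.Reachable.refl _)))
          · exact .inl rfl
          · exact .inr (.inl rfl)
        · have hab : K.Adj a b := ⟨h, fun h => hD h.1⟩
          have hr : K.Reachable a b := hab.reachable
          rcases ih hy with rfl | rfl | h' | h'
          · exfalso; apply hD; rcases (hw a).1 h.symm with h | h | h <;> simp [D, h]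
          · exfalso; apply hD; rcases (hz a).1 h.symm with h | h | h <;> simp [D, h]
          · exact .inr (.inr (.inl (hr.trans h')))
          · exact .inr (.inr (.inr (hr.trans h')))
    intro x
    obtain ⟨p⟩ := hconn.preconnected x u
    exact gen x u rfl p
  have hKw : ∀ y, ¬ K.Adj w y := by
    rintro y ⟨h, h'⟩
    apply h'
    rcases (hw y).1 h with h | h | h <;> simp [D, h]
  have hKz : ∀ y, ¬ K.Adj z y := by
    rintro y ⟨h, h'⟩
    apply h'
    rcases (hz y).1 h with h | h | h <;> simp [D, h]
  obtain ⟨o, ho, hpar⟩ := par_push K K.edgeFinset (by simp) u v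
    (Finset.univ.filter fun x => ¬ D x) (by
      intro x hx
      simp only [Finset.mem_filter, Finset.mem_univ, true_and, D] at hx
      have := hreach x
      tauto)
  have hpar0 : ∀ t, (∀ y, ¬ K.Adj t y) → par K.edgeFinset o t = 0 := by
    intro t ht
    apply Finset.sum_eq_zero
    intro e he
    rw [if_neg]
    rintro rfl
    obtain ⟨y, hy⟩ := Sym2.mem_iff_exists.1 (ho e he)
    rw [hy] at he
    exact ht y (by simpa using he)
  obtain ⟨su, hsu⟩ : ∃ p : Prop, p ↔ par K.edgeFinset o u = 1 := ⟨_, Iff.rfl⟩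
  obtain ⟨sv, hsv⟩ : ∃ p : Prop, p ↔ par K.edgeFinset o v = 1 := ⟨_, Iff.rfl⟩
  obtain ⟨H, hHA⟩ : ∃ H : SimpleGraph V, ∀ x y, H.Adj x y ↔
      (K.Adj x y ∨ (su ∧ s(x, y) = s(u, w)) ∨ (sv ∧ s(x, y) = s(v, w))) := ⟨
    { Adj := fun x y => K.Adj x y ∨ (su ∧ s(x, y) = s(u, w)) ∨ (sv ∧ s(x, y) = s(v, w))
      symm := ⟨fun x y h => by rw [Sym2.eq_swap, K.adj_comm]; exact h⟩
      loopless := ⟨fun x h => by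
        rcases h with h | ⟨_, h⟩ | ⟨_, h⟩
        · exact h.ne rfl
        · rw [Sym2.eq_iff] at h; grind
        · rw [Sym2.eq_iff] at h; grind⟩ }, fun x y => Iff.rfl⟩
  have hHG : ∀ x y, x ≠ u → x ≠ v → x ≠ w → x ≠ z → (H.Adj x y ↔ G.Adj x y) := by
    intro x y h1 h2 h3 h4
    rw [hHA, hKA]
    simp [h1, h2, h3, h4, D]
  have hHu : ∀ y, H.Adj u y ↔ (y = w ∧ su) ∨ y ∈ U := by
    intro y
    rw [hHA, hKA, hUm]
    simp only [Sym2.eq_iff, D]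
    constructor
    · grind
    · rintro (⟨rfl, h⟩ | ⟨h1, h2, h3⟩)
      · simp [h]
      · left
        have := hUd y ((hUm y).2 ⟨h1, h2, h3⟩)
        tauto
  have hHv : ∀ y, H.Adj v y ↔ (y = w ∧ sv) ∨ y ∈ S := by
    intro y
    rw [hHA, hKA, hSm]
    simp only [Sym2.eq_iff, D]
    constructor
    · grind
    · rintro (⟨rfl, h⟩ | ⟨h1, h2, h3⟩)
      · simp [h]
      · left
        have := hSd y ((hSm y).2 ⟨h1, h2, h3⟩)
        tauto
  have hHw : ∀ y, H.Adj w y ↔ (y = u ∧ su) ∨ (y = v ∧ sv) := by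
    intro y
    rw [hHA]
    simp only [hKw, Sym2.eq_iff]
    grind
  have hHz : ∀ y, ¬ H.Adj z y := by
    intro y
    rw [hHA]
    simp only [hKz, Sym2.eq_iff]
    grind
  have hle : H ≤ G := by
    intro x y h
    rcases (hHA x y).1 h with h | ⟨_, h⟩ | ⟨_, h⟩
    · exact h.1
    · rw [← SimpleGraph.mem_edgeSet, h]; exact auw
    · rw [← SimpleGraph.mem_edgeSet, h]; exact avw
  have hdegH : MaxDegreeLE H 3 := fun x =>
    (Set.ncard_le_ncard (fun y hy => hle hy) (Set.toFinite _)).trans (hdeg x)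
  refine extend G H u v w z huv huw huz hvw hvz hwz hdegH hw hz U S hUc hSc hU hS hUd hSd su sv
    hHG hHu hHv hHw ?_
  refine transfer H G.edgeSet.ncard hmin ?_ ?_ hdegH ?_
  · -- decomposable
    have hne1 : s(u, w) ≠ s(v, w) := by rw [Ne, Sym2.eq_iff]; grind
    have n1 : s(u, w) ∉ K.edgeFinset := by
      rw [SimpleGraph.mem_edgeFinset, SimpleGraph.mem_edgeSet, K.adj_comm]; exact hKw u
    have n2 : s(v, w) ∉ K.edgeFinset := by
      rw [SimpleGraph.mem_edgeFinset, SimpleGraph.mem_edgeSet, K.adj_comm]; exact hKw v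
    let o' : Sym2 V → V := fun e => if e = s(u, w) then u else if e = s(v, w) then v else o e
    have o1 : o' s(u, w) = u := by simp [o']
    have o2 : o' s(v, w) = v := by simp [o', hne1.symm]
    have o3 : ∀ e ∈ K.edgeFinset, o' e = o e := by
      intro e he
      have h1 : e ≠ s(u, w) := by rintro rfl; exact n1 he
      have h2 : e ≠ s(v, w) := by rintro rfl; exact n2 he
      simp [o', h1, h2]
    obtain ⟨E, hEdge⟩ : ∃ E, E = K.edgeFinset ∪ ((if su then {s(u, w)} else ∅) ∪
        (if sv then {s(v, w)} else ∅)) := ⟨_, rfl⟩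
    have hEm : ∀ e, e ∈ E ↔ e ∈ H.edgeSet := by
      intro e
      rw [hEdge]
      induction e with
      | _ x y =>
        simp only [SimpleGraph.mem_edgeFinset, SimpleGraph.mem_edgeSet, Finset.mem_union, hHA]
        by_cases h1 : su <;> by_cases h2 : sv <;> simp [h1, h2]
    refine decomp_of_even H E hEm o' ?_ ?_
    · intro e he
      rw [hEdge] at he
      rcases Finset.mem_union.1 he with he | he
      · rw [o3 e he]; exact ho e he
      · rcases Finset.mem_union.1 he with he | he
        · by_cases h : su
          · simp only [h, if_true, Finset.mem_singleton] at he
            rw [he, o1]; simp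
          · simp [h] at he
        · by_cases h : sv
          · simp only [h, if_true, Finset.mem_singleton] at he
            rw [he, o2]; simp
          · simp [h] at he
    · intro t
      have hsum : par E o' t = par K.edgeFinset o t +
          ((if su then (if u = t then 1 else 0) else 0) +
          (if sv then (if v = t then 1 else 0) else 0)) := by
        unfold par
        rw [hEdge, Finset.sum_union, Finset.sum_union]
        · congr 1
          · exact Finset.sum_congr rfl fun e he => by rw [o3 e he]
          · congr 1
            · by_cases h : su <;> simp [h, o1, -Finset.sum_boole]
            · by_cases h : sv <;> simp [h, o2, -Finset.sum_boole]
        · by_cases h1 : su <;> by_cases h2 : sv <;> simp [h1, h2, huv, hne1]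
        · by_cases h1 : su <;> by_cases h2 : sv <;>
            simp only [h1, h2, if_true, if_false, Finset.disjoint_left, Finset.mem_union,
              Finset.mem_singleton, Finset.notMem_empty] <;> rintro e he h <;> grind
      rw [hsum]
      have h01 : ∀ a : ZMod 2, a ≠ 1 → a = 0 := by decide
      have h11 : (1 : ZMod 2) + 1 = 0 := by decide
      by_cases hD : D t
      · rcases hD with rfl | rfl | rfl | rfl
        · by_cases h : su
          · have h' := hsu.1 h
            simp [h, h', huv.symm, h11]
          · simp [h, huv.symm, h01 _ (fun h' => h (hsu.2 h'))]
        · by_cases h : sv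
          · have h' := hsv.1 h
            simp [h, h', huv, h11]
          · simp [h, huv, h01 _ (fun h' => h (hsv.2 h'))]
        · simp [hpar0 t hKw, huw, hvw]
        · simp [hpar0 t hKz, huz, hvz]
      · rw [hpar t (by simpa using hD)]
        have h1 : u ≠ t := fun h => hD (.inl h.symm)
        have h2 : v ≠ t := fun h => hD (.inr (.inl h.symm))
        simp [h1, h2]
  · -- claw-free
    rintro ⟨x, a, b, d, hab, had, hbd, ha, hb, hd, nab, nad, nbd⟩
    have small : ∀ (T : Finset V) (p : V), T.card ≤ 1 →
        (∀ y, H.Adj x y → y = p ∨ y ∈ T) → False := by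
      intro T p hT h
      exact small_nbr T p a b d hT hab had hbd (h a ha) (h b hb) (h d hd)
    by_cases hD : D x
    · rcases hD with rfl | rfl | rfl | rfl
      · exact small U w hUc (fun y hy => by have := (hHu y).1 hy; tauto)
      · exact small S w hSc (fun y hy => by have := (hHv y).1 hy; tauto)
      · exact small {u} v (by simp) (fun y hy => by have := (hHw y).1 hy; simp; tauto)
      · exact hHz _ ha
    · have hx1 : x ≠ u := fun h => hD (.inl h)
      have hx2 : x ≠ v := fun h => hD (.inr (.inl h))
      have hx3 : x ≠ w := fun h => hD (.inr (.inr (.inl h)))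
      have hx4 : x ≠ z := fun h => hD (.inr (.inr (.inr h)))
      have q : ∀ p q, H.Adj x p → H.Adj x q → ¬ H.Adj p q → ¬ G.Adj p q := by
        intro p q hp hq hpq hG
        have nw : ∀ p, H.Adj x p → p ≠ w ∧ p ≠ z := by
          intro p hp
          have hp := (hle hp).symm
          constructor
          · rintro rfl; have := (hw x).1 hp; tauto
          · rintro rfl; have := (hz x).1 hp; tauto
        have n1 := nw p hp
        have n2 := nw q hq
        apply hpq
        rw [hHA, hKA]
        left
        refine ⟨hG, ?_⟩
        rintro ⟨h1, h2⟩
        have h1' : p = u ∨ p = v := by simp only [D] at h1; tauto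
        have h2' : q = u ∨ q = v := by simp only [D] at h2; tauto
        rcases h1' with rfl | rfl <;> rcases h2' with rfl | rfl
        · exact hG.ne rfl
        · exact auv hG
        · exact avu hG
        · exact hG.ne rfl
      exact hclaw ⟨x, a, b, d, hab, had, hbd, hle ha, hle hb, hle hd,
        q a b ha hb nab, q a d ha hd nad, q b d hb hd nbd⟩
  · -- fewer edges
    apply Set.ncard_lt_ncard _ (Set.toFinite _)
    refine ⟨SimpleGraph.edgeSet_mono hle, fun h => ?_⟩
    have : s(z, w) ∈ H.edgeSet := h (by simpa using awz.symm)
    exact hHz w (by simpa using this)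

end Aux

/-- In a minimal counterexample to the 3-color theorem for claw-free subcubic graphs, there are no two triangles sharing an edge. -/
theorem minimal_cex_no_adjacent_triangles {V : Type*} [Fintype V] (G : SimpleGraph V)
    (hconn : G.Connected) (hdec : Decomposable G) (hclaw : ClawFree G)
    (hdeg : MaxDegreeLE G 3) (hG : ¬ HasLIEC G 3)
    (hmin : ∀ (W : Type) [Fintype W] (H : SimpleGraph W),
      Decomposable H → ClawFree H → MaxDegreeLE H 3 →
      H.edgeSet.ncard < G.edgeSet.ncard → HasLIEC H 3) :
    ¬ ∃ u v w z : V, u ≠ v ∧ u ≠ w ∧ u ≠ z ∧ v ≠ w ∧ v ≠ z ∧ w ≠ z ∧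
      G.Adj w z ∧ G.Adj u w ∧ G.Adj u z ∧ G.Adj v w ∧ G.Adj v z := by
  rintro ⟨u, v, w, z, huv, huw, huz, hvw, hvz, hwz, awz, auw, auz, avw, avz⟩
  exact hG (core G hconn hclaw hdeg hmin u v w z huv huw huz hvw hvz hwz awz auw auz avw avz)
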